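/- arXiv:2406.17336 — 2 statements merged into one kernel-verified Lean document; each statement's English description precedes it below -/
import Mathlib

section
/- The dual lattice of the even kernel Λ₀ is generated over ℤ by Λ* and half the characteristic vector: (Λ₀)* = Λ* + ℤ·(½W₂) as subgroups of V, where (Λ₀)* := {x ∈ V : B(x,λ) ∈ ℤ for all λ ∈ Λ₀}. -/
open scoped Classical

noncomputable section

/-- The group `ℚ/ℤ`. -/
abbrev QZ : Type := AddCircle (1 : ℚ)

/-- A lattice datum: a finite-dimensional ℚ-vector space `V` with a nondegenerate
symmetric bilinear form `B`, a full lattice `Λ = L` (finitely generated ℤ-submodule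
spanning `V` over ℚ, on which `B` is integral), and a characteristic vector `W = W₂ ∈ Λ*`
(`B(W₂,λ) − B(λ,λ) ∈ 2ℤ` for all `λ ∈ Λ`). -/
structure LatticeDatum (V : Type*) [AddCommGroup V] [Module ℚ V] where
  B : V → V → ℚ
  B_add_left : ∀ x y z : V, B (x + y) z = B x z + B y z
  B_smul_left : ∀ (c : ℚ) (x y : V), B (c • x) y = c * B x y
  B_symm : ∀ x y : V, B x y = B y x
  B_nondeg : ∀ x : V, (∀ y : V, B x y = 0) → x = 0
  L : Submodule ℤ V
  L_fg : L.FG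
  L_full : Submodule.span ℚ (L : Set V) = ⊤
  L_int : ∀ x ∈ L, ∀ y ∈ L, ∃ n : ℤ, B x y = (n : ℚ)
  W : V
  W_dual : ∀ l ∈ L, ∃ n : ℤ, B W l = (n : ℚ)
  W_char : ∀ l ∈ L, ∃ n : ℤ, B W l - B l l = 2 * (n : ℚ)

namespace LatticeDatum

variable {V : Type*} [AddCommGroup V] [Module ℚ V] (D : LatticeDatum V)

theorem B_zero_left (y : V) : D.B 0 y = 0 := by
  have h := D.B_add_left 0 0 y
  rw [add_zero] at h
  linarith

theorem B_neg_left (x y : V) : D.B (-x) y = - D.B x y := by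
  have h := D.B_add_left x (-x) y
  rw [add_neg_cancel, D.B_zero_left] at h
  linarith

theorem B_add_right (x y z : V) : D.B x (y + z) = D.B x y + D.B x z := by
  rw [D.B_symm x (y + z), D.B_add_left, D.B_symm y x, D.B_symm z x]

theorem B_zero_right (x : V) : D.B x 0 = 0 := by
  rw [D.B_symm x 0, D.B_zero_left]

theorem B_neg_right (x y : V) : D.B x (-y) = - D.B x y := by
  rw [D.B_symm x (-y), D.B_neg_left, D.B_symm y x]

/-- The dual of a subset `s ⊆ V` with respect to `B`:
`s* = {x ∈ V : B(x,l) ∈ ℤ for all l ∈ s}`, as a subgroup of `V`. -/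
def dual (s : Set V) : AddSubgroup V where
  carrier := {x | ∀ l ∈ s, ∃ n : ℤ, D.B x l = (n : ℚ)}
  zero_mem' := fun l _ => ⟨0, by rw [D.B_zero_left]; norm_num⟩
  add_mem' := by
    intro x y hx hy l hl
    obtain ⟨n, hn⟩ := hx l hl
    obtain ⟨m, hm⟩ := hy l hl
    exact ⟨n + m, by rw [D.B_add_left, hn, hm]; push_cast; ring⟩
  neg_mem' := by
    intro x hx l hl
    obtain ⟨n, hn⟩ := hx l hl
    exact ⟨-n, by rw [D.B_neg_left, hn]; push_cast; ring⟩

/-- The even kernel `Λ₀ = {λ ∈ Λ : B(W₂,λ) ∈ 2ℤ}`, as a subgroup of `V`. -/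
def L0 : AddSubgroup V where
  carrier := {l | l ∈ D.L ∧ ∃ n : ℤ, D.B D.W l = 2 * (n : ℚ)}
  zero_mem' := ⟨D.L.zero_mem, 0, by rw [D.B_zero_right]; norm_num⟩
  add_mem' := by
    rintro x y ⟨hxL, n, hn⟩ ⟨hyL, m, hm⟩
    exact ⟨D.L.add_mem hxL hyL, n + m, by rw [D.B_add_right, hn, hm]; push_cast; ring⟩
  neg_mem' := by
    rintro x ⟨hxL, n, hn⟩
    exact ⟨D.L.neg_mem hxL, -n, by rw [D.B_neg_right, hn]; push_cast; ring⟩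

/-- The discriminant group `Λ*/Λ`. -/
abbrev disc : Type _ :=
  ↥(D.dual (D.L : Set V)) ⧸ (D.L.toAddSubgroup.addSubgroupOf (D.dual (D.L : Set V)))

/-- The projection `Λ* → Λ*/Λ`. -/
def discProj : ↥(D.dual (D.L : Set V)) →+ D.disc := QuotientAddGroup.mk' _

/-- The group `G = (Λ₀)*/Λ₀`. -/
abbrev disc0 : Type _ :=
  ↥(D.dual (D.L0 : Set V)) ⧸ ((D.L0).addSubgroupOf (D.dual (D.L0 : Set V)))

/-- The projection `(Λ₀)* → (Λ₀)*/Λ₀`. -/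
def disc0Proj : ↥(D.dual (D.L0 : Set V)) →+ D.disc0 := QuotientAddGroup.mk' _

end LatticeDatum

namespace LatticeDatum

variable {V : Type*} [AddCommGroup V] [Module ℚ V] (D : LatticeDatum V)

theorem B_zsmul_half_W_left (m : ℤ) (l : V) :
    D.B (m • ((1/2 : ℚ) • D.W)) l = m * (1/2 * D.B D.W l) := by
  rw [← Int.cast_smul_eq_zsmul ℚ, D.B_smul_left, D.B_smul_left]

theorem dual_anti {s t : Set V} (h : s ⊆ t) : D.dual t ≤ D.dual s :=
  fun _ hx l hl => hx l (h hl)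

theorem L0_subset_L : (D.L0 : Set V) ⊆ (D.L : Set V) := fun _ hl => hl.1

theorem half_W_mem_dual_L0 : (1/2 : ℚ) • D.W ∈ D.dual (D.L0 : Set V) := by
  rintro l ⟨-, n, hn⟩
  exact ⟨n, by rw [D.B_smul_left, hn]; ring⟩

/-- Every element of `(Λ₀)*` differs from an element of `Λ*` by a multiple of `½W₂`. -/
theorem exists_sub_zsmul_half_W_mem_dual {x : V} (hx : x ∈ D.dual (D.L0 : Set V)) :
    ∃ m : ℤ, x - m • ((1/2 : ℚ) • D.W) ∈ D.dual (D.L : Set V) := by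
  by_cases h : ∀ l ∈ D.L, l ∈ D.L0
  · exact ⟨0, by rw [zero_smul, sub_zero]; exact fun l hl => hx l (h l hl)⟩
  push Not at h
  obtain ⟨l₁, hl₁, hl₁'⟩ := h
  have odd_of_notMem : ∀ l ∈ D.L, l ∉ D.L0 → ∃ k : ℤ, D.B D.W l = 2 * (k : ℚ) + 1 := by
    intro l hl hl'
    obtain ⟨n, hn⟩ := D.W_dual l hl
    obtain ⟨k, rfl | rfl⟩ := Int.even_or_odd' n
    · exact absurd ⟨hl, k, by rw [hn]; push_cast; ring⟩ hl'
    · exact ⟨k, by rw [hn]; push_cast; ring⟩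
  obtain ⟨k, hk⟩ := odd_of_notMem l₁ hl₁ hl₁'
  have hdouble : l₁ + l₁ ∈ D.L0 :=
    ⟨D.L.add_mem hl₁ hl₁, 2 * k + 1, by rw [D.B_add_right, hk]; push_cast; ring⟩
  obtain ⟨m, hm⟩ := hx _ hdouble
  rw [D.B_add_right] at hm
  refine ⟨m, fun l hl => ?_⟩
  rw [sub_eq_add_neg, D.B_add_left, D.B_neg_left, D.B_zsmul_half_W_left]
  by_cases hl' : l ∈ D.L0
  · obtain ⟨n, hn⟩ := hx l hl'
    obtain ⟨-, j, hj⟩ := hl'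
    exact ⟨n - m * j, by rw [hn, hj]; push_cast; ring⟩
  · obtain ⟨j, hj⟩ := odd_of_notMem l hl hl'
    have hdiff : l + -l₁ ∈ D.L0 :=
      ⟨D.L.add_mem hl (D.L.neg_mem hl₁), j - k, by
        rw [D.B_add_right, D.B_neg_right, hj, hk]; push_cast; ring⟩
    obtain ⟨n, hn⟩ := hx _ hdiff
    rw [D.B_add_right, D.B_neg_right] at hn
    exact ⟨n - m * j, by rw [hj]; push_cast; linarith⟩

end LatticeDatum

/-- `(Λ₀)* = Λ* + ℤ·(½W₂)` as subgroups of `V`. -/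
theorem statement13 {V : Type*} [AddCommGroup V] [Module ℚ V] [FiniteDimensional ℚ V]
    (D : LatticeDatum V) :
    D.dual (D.L0 : Set V)
      = D.dual (D.L : Set V) ⊔ AddSubgroup.zmultiples ((1/2 : ℚ) • D.W) := by
  apply le_antisymm
  · intro x hx
    obtain ⟨m, hm⟩ := D.exists_sub_zsmul_half_W_mem_dual hx
    exact AddSubgroup.mem_sup.mpr
      ⟨_, hm, _, AddSubgroup.zsmul_mem_zmultiples _ m, sub_add_cancel _ _⟩
  · exact sup_le (D.dual_anti D.L0_subset_L)
      (AddSubgroup.zmultiples_le_of_mem D.half_W_mem_dual_L0)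
end
end

section
/- Assume Λ₀ ≠ Λ, let G := (Λ₀)*/Λ₀ with q̂([x]) := ½·B(x,x) mod ℤ and fermion f the class of any μ ∈ Λ∖Λ₀, and let b̂ be the bilinear form b̂(g,h) := q̂(g+h) − q̂(g) − q̂(h) on G, which satisfies b̂([x],[y]) = B(x,y) mod ℤ. Then: (i) the subgroup G₀ := {g ∈ G : b̂(g,f) = 0} is exactly the image of Λ* in G, i.e. G₀ = Λ*/Λ₀; (ii) the class of ½W₂ lies in G∖G₀; (iii) the natural map Λ* → G₀/⟨f⟩ induces a group isomorphism Λ*/Λ ≅ G₀/⟨f⟩; and (iv) under this isomorphism the form q_{[½W₂]}, defined by q_{[½W₂]}([x]) = q̂([x] − [½W₂]) for x ∈ Λ*, corresponds to the discriminant form q([x]) = ½·B(x, x−W₂) + ⅛·B(W₂,W₂) mod ℤ on Λ*/Λ; concretely, ½·B(x − ½W₂, x − ½W₂) − (½·B(x, x−W₂) + ⅛·B(W₂,W₂)) ∈ ℤ... in fact these two rational numbers are equal for every x ∈ Λ*. -/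
open scoped Classical

noncomputable section

namespace LatticeDatum

variable {V : Type*} [AddCommGroup V] [Module ℚ V] (D : LatticeDatum V)

theorem B_sub_left (x y z : V) : D.B (x - y) z = D.B x z - D.B y z := by
  rw [sub_eq_add_neg, D.B_add_left, D.B_neg_left, sub_eq_add_neg]

theorem B_sub_right (x y z : V) : D.B x (y - z) = D.B x y - D.B x z := by
  rw [sub_eq_add_neg, D.B_add_right, D.B_neg_right, sub_eq_add_neg]

theorem B_smul_right (c : ℚ) (x y : V) : D.B x (c • y) = c * D.B x y := by
  rw [D.B_symm, D.B_smul_left, D.B_symm]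

theorem half_B_sub_half_W (x : V) :
    (1/2) * D.B (x - (1/2 : ℚ) • D.W) (x - (1/2 : ℚ) • D.W)
      = (1/2) * D.B x (x - D.W) + (1/8) * D.B D.W D.W := by
  simp only [B_sub_left, B_sub_right, B_smul_right, B_smul_left, D.B_symm D.W x]
  ring

theorem L0_le : D.L0 ≤ D.L.toAddSubgroup := fun _ h => h.1

/-- Elements of `Λ ∖ Λ₀` pair with `W₂` to an odd integer. -/
theorem exists_odd_of_notMem_L0 {l : V} (hl : l ∈ D.L) (hl0 : l ∉ D.L0) :
    ∃ n : ℤ, D.B D.W l = 2 * (n : ℚ) + 1 := by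
  obtain ⟨n, hn⟩ := D.W_dual l hl
  obtain ⟨k, rfl | rfl⟩ := n.even_or_odd'
  · exact absurd ⟨hl, k, by rw [hn]; push_cast; ring⟩ hl0
  · exact ⟨k, by rw [hn]; push_cast; ring⟩

/-- `Λ₀` has index at most two in `Λ`. -/
theorem sub_mem_L0 {l m : V} (hl : l ∈ D.L) (hl0 : l ∉ D.L0) (hm : m ∈ D.L) (hm0 : m ∉ D.L0) :
    l - m ∈ D.L0 := by
  obtain ⟨a, ha⟩ := D.exists_odd_of_notMem_L0 hl hl0
  obtain ⟨b, hb⟩ := D.exists_odd_of_notMem_L0 hm hm0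
  exact ⟨D.L.sub_mem hl hm, a - b, by rw [D.B_sub_right, ha, hb]; push_cast; ring⟩

/-- For `μ ∈ Λ ∖ Λ₀`, an element of `(Λ₀)*` lies in `Λ*` iff it pairs integrally with `μ`. -/
theorem mem_dual_L_iff {μ : V} (hμL : μ ∈ D.L) (hμ0 : μ ∉ D.L0) {x : V}
    (hx : x ∈ D.dual (D.L0 : Set V)) :
    x ∈ D.dual (D.L : Set V) ↔ ∃ n : ℤ, D.B x μ = (n : ℚ) := by
  refine ⟨fun h => h μ hμL, fun ⟨n, hn⟩ l hl => ?_⟩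
  by_cases hl0 : l ∈ D.L0
  · exact hx l hl0
  · obtain ⟨m, hm⟩ := hx (l - μ) (D.sub_mem_L0 hl hl0 hμL hμ0)
    rw [D.B_sub_right] at hm
    exact ⟨m + n, by push_cast; linarith⟩

theorem half_W_notMem_dual_L {μ : V} (hμL : μ ∈ D.L) (hμ0 : μ ∉ D.L0) :
    (1/2 : ℚ) • D.W ∉ D.dual (D.L : Set V) := by
  intro h
  obtain ⟨n, hn⟩ := h μ hμL
  obtain ⟨k, hk⟩ := D.exists_odd_of_notMem_L0 hμL hμ0
  rw [D.B_smul_left, hk] at hn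
  have : 2 * k + 1 = 2 * n := by
    have : (2 * k + 1 : ℚ) = 2 * n := by linarith
    exact_mod_cast this
  omega

theorem disc0Proj_eq_iff (x y : ↥(D.dual (D.L0 : Set V))) :
    D.disc0Proj x = D.disc0Proj y ↔ (x - y : V) ∈ D.L0 := by
  rw [← sub_eq_zero, ← map_sub]
  exact (QuotientAddGroup.eq_zero_iff _).trans AddSubgroup.mem_addSubgroupOf

theorem disc0Proj_eq_zero_iff (x : ↥(D.dual (D.L0 : Set V))) :
    D.disc0Proj x = 0 ↔ (x : V) ∈ D.L0 :=
  (QuotientAddGroup.eq_zero_iff _).trans AddSubgroup.mem_addSubgroupOf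

/-- The polarization of `q̂` is `B` modulo `ℤ`. -/
theorem polar_qhat {qhat : D.disc0 → QZ}
    (hqhat : ∀ x : ↥(D.dual (D.L0 : Set V)),
      qhat (D.disc0Proj x) = (((1/2) * D.B ↑x ↑x : ℚ) : QZ))
    (x y : ↥(D.dual (D.L0 : Set V))) :
    qhat (D.disc0Proj x + D.disc0Proj y) - qhat (D.disc0Proj x) - qhat (D.disc0Proj y)
      = ((D.B ↑x ↑y : ℚ) : QZ) := by
  rw [← map_add, hqhat, hqhat, hqhat, ← AddCircle.coe_sub, ← AddCircle.coe_sub]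
  congr 1
  simp only [AddSubgroup.coe_add, B_add_left, B_add_right, D.B_symm y x]
  ring

end LatticeDatum

theorem QZ.coe_eq_zero_iff (r : ℚ) : (r : QZ) = 0 ↔ ∃ n : ℤ, r = (n : ℚ) := by
  rw [AddCircle.coe_eq_zero_iff]
  simp [eq_comm]

/-- with `G = (Λ₀)*/Λ₀`, `q̂([x]) = ½B(x,x)`, fermion `f` the class of
`μ ∈ Λ∖Λ₀`, and `b̂(g,h) = q̂(g+h) − q̂(g) − q̂(h)`:
(i) `G₀ = {g : b̂(g,f) = 0}` is exactly the image of `Λ*` in `G`;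
(ii) the class of `½W₂` lies in `G∖G₀`;
(iii) the natural map `Λ* → G₀/⟨f⟩` induces an isomorphism `Λ*/Λ ≅ G₀/⟨f⟩`, expressed
here by: `Λ* ⊆ (Λ₀)*`, the fibre of `{0, f}` is exactly `Λ`, and every element of `G₀`
is the class of some `x ∈ Λ*`;
(iv) under this correspondence `q_{[½W₂]}` is the discriminant form
`q([x]) = ½B(x, x−W₂) + ⅛B(W₂,W₂)`; in fact the two rational numbers
`½B(x−½W₂, x−½W₂)` and `½B(x, x−W₂) + ⅛B(W₂,W₂)` are equal for every `x ∈ Λ*`. -/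
theorem statement15 {V : Type*} [AddCommGroup V] [Module ℚ V] [FiniteDimensional ℚ V]
    (D : LatticeDatum V)
    (hne : (D.L0 : Set V) ≠ (D.L : Set V))
    (qhat : D.disc0 → QZ)
    (hqhat : ∀ x : ↥(D.dual (D.L0 : Set V)),
      qhat (D.disc0Proj x) = (((1/2) * D.B ↑x ↑x : ℚ) : QZ))
    (μ : V) (hμd : μ ∈ D.dual (D.L0 : Set V)) (hμL : μ ∈ D.L) (hμ0 : μ ∉ D.L0)
    (f : D.disc0) (hf : f = D.disc0Proj ⟨μ, hμd⟩) :
    (∀ g : D.disc0,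
        qhat (g + f) - qhat g - qhat f = 0
          ↔ ∃ (x : V) (hx : x ∈ D.dual (D.L0 : Set V)),
              x ∈ D.dual (D.L : Set V) ∧ g = D.disc0Proj ⟨x, hx⟩)
      ∧ ∃ hW : (1/2 : ℚ) • D.W ∈ D.dual (D.L0 : Set V),
          (qhat (D.disc0Proj ⟨(1/2 : ℚ) • D.W, hW⟩ + f)
              - qhat (D.disc0Proj ⟨(1/2 : ℚ) • D.W, hW⟩) - qhat f ≠ 0)
          ∧ D.dual (D.L : Set V) ≤ D.dual (D.L0 : Set V)
          ∧ (∀ (x : V) (hx0 : x ∈ D.dual (D.L0 : Set V)), x ∈ D.dual (D.L : Set V) →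
              ((D.disc0Proj ⟨x, hx0⟩ = 0 ∨ D.disc0Proj ⟨x, hx0⟩ = f) ↔ x ∈ D.L))
          ∧ (∀ (x : V) (hx0 : x ∈ D.dual (D.L0 : Set V)), x ∈ D.dual (D.L : Set V) →
              qhat (D.disc0Proj ⟨x, hx0⟩ - D.disc0Proj ⟨(1/2 : ℚ) • D.W, hW⟩)
                = (((1/2) * D.B x (x - D.W) + (1/8) * D.B D.W D.W : ℚ) : QZ))
          ∧ (∀ x ∈ D.dual (D.L : Set V),
              (1/2) * D.B (x - (1/2 : ℚ) • D.W) (x - (1/2 : ℚ) • D.W)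
                = (1/2) * D.B x (x - D.W) + (1/8) * D.B D.W D.W) := by
  subst hf
  have hle : D.dual (D.L : Set V) ≤ D.dual (D.L0 : Set V) := D.dual_anti D.L0_le
  have hb (x : V) (hx : x ∈ D.dual (D.L0 : Set V)) :
      qhat (D.disc0Proj ⟨x, hx⟩ + D.disc0Proj ⟨μ, hμd⟩) - qhat (D.disc0Proj ⟨x, hx⟩)
        - qhat (D.disc0Proj ⟨μ, hμd⟩) = 0 ↔ x ∈ D.dual (D.L : Set V) := by
    rw [D.polar_qhat hqhat, QZ.coe_eq_zero_iff, D.mem_dual_L_iff hμL hμ0 hx]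
  refine ⟨fun g => ?_, D.half_W_mem_dual_L0, ?_, hle, fun x hx0 _ => ?_, fun x hx0 _ => ?_,
    fun x _ => D.half_B_sub_half_W x⟩
  · constructor
    · obtain ⟨⟨x, hx⟩, rfl⟩ := QuotientAddGroup.mk'_surjective _ g
      exact fun h => ⟨x, hx, (hb x hx).1 h, rfl⟩
    · rintro ⟨x, hx, hxL, rfl⟩
      exact (hb x hx).2 hxL
  · rw [Ne, hb]
    exact D.half_W_notMem_dual_L hμL hμ0
  · rw [D.disc0Proj_eq_zero_iff, D.disc0Proj_eq_iff]
    constructor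
    · rintro (h | h)
      · exact h.1
      · simpa using D.L.add_mem h.1 hμL
    · intro hx
      by_cases h : x ∈ D.L0
      · exact Or.inl h
      · exact Or.inr (D.sub_mem_L0 hx h hμL hμ0)
  · rw [← map_sub, hqhat, ← D.half_B_sub_half_W]
    rfl
end
end
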